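/- If X is a random variable with E X = 0 and l(x) = E[|X|^2 1_{|X| ≤ x}] is slowly varying as x → ∞ with E|X|^2 = ∞, then P(|X| ≥ x) = o(l(x)/x^2) as x → ∞. -/

import Mathlib

open MeasureTheory ProbabilityTheory Filter Asymptotics
open scoped ENNReal

lemma key_aux {Ω : Type*} [MeasurableSpace Ω] (μ : Measure Ω) [IsProbabilityMeasure μ]
    (X : Ω → ℝ) (hX : AEMeasurable X μ) (x : ℝ) (hx : 0 < x) :
    x ^ 2 * μ.real {ω | x ≤ |X ω|} ≤ (∫ ω in {ω | |X ω| ≤ 2 * x}, |X ω| ^ 2 ∂μ)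
      - (∫ ω in {ω | |X ω| ≤ (1 / 2) * x}, |X ω| ^ 2 ∂μ) + x ^ 2 * μ.real {ω | 2 * x ≤ |X ω|} := by
  have hXa : AEMeasurable (fun ω => |X ω|) μ := by
    simpa only [Real.norm_eq_abs] using hX.norm
  have hle : ∀ c : ℝ, NullMeasurableSet {ω | |X ω| ≤ c} μ := fun c =>
    nullMeasurableSet_le hXa aemeasurable_const
  have hge : ∀ c : ℝ, NullMeasurableSet {ω | c ≤ |X ω|} μ := fun c =>
    nullMeasurableSet_le aemeasurable_const hXa
  have hint : ∀ c : ℝ, IntegrableOn (fun ω => |X ω| ^ 2) {ω | |X ω| ≤ c} μ := by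
    intro c
    refine IntegrableOn.of_bound (measure_lt_top _ _) (hXa.pow_const 2).aestronglyMeasurable.restrict
      (c ^ 2) ?_
    refine (ae_restrict_iff'₀ (hle c)).2 (Eventually.of_forall fun ω hω => ?_)
    have h : |X ω| ≤ c := hω
    rw [Real.norm_eq_abs, abs_of_nonneg (by positivity)]
    gcongr
  set B : Set Ω := {ω | x ≤ |X ω|} ∩ {ω | |X ω| ≤ 2 * x} with hB
  have hBm : NullMeasurableSet B μ := (hge x).inter (hle _)
  have h1 : μ.real {ω | x ≤ |X ω|} ≤ μ.real B + μ.real {ω | 2 * x ≤ |X ω|} := by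
    refine (measureReal_mono ?_).trans (measureReal_union_le _ _)
    intro ω hω
    rcases le_total (|X ω|) (2 * x) with h | h
    · exact Or.inl ⟨hω, h⟩
    · exact Or.inr h
  have hBi : IntegrableOn (fun ω => |X ω| ^ 2) B μ := (hint (2 * x)).mono_set Set.inter_subset_right
  have h2 : x ^ 2 * μ.real B ≤ ∫ ω in B, |X ω| ^ 2 ∂μ := by
    have : ∫ ω in B, x ^ 2 ∂μ = x ^ 2 * μ.real B := by
      rw [setIntegral_const, smul_eq_mul, mul_comm]
    rw [← this]
    refine integral_mono_ae (integrable_const _) hBi ?_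
    refine (ae_restrict_iff'₀ hBm).2 (Eventually.of_forall fun ω hω => ?_)
    have h : x ≤ |X ω| := hω.1
    show x ^ 2 ≤ |X ω| ^ 2
    gcongr
  have h3 : (∫ ω in {ω | |X ω| ≤ (1 / 2) * x}, |X ω| ^ 2 ∂μ) + ∫ ω in B, |X ω| ^ 2 ∂μ
      ≤ ∫ ω in {ω | |X ω| ≤ 2 * x}, |X ω| ^ 2 ∂μ := by
    rw [← setIntegral_union₀ _ hBm (hint _) hBi]
    · refine setIntegral_mono_set (hint _) (Eventually.of_forall fun ω => by positivity) ?_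
      refine HasSubset.Subset.eventuallyLE ?_
      rintro ω (h | h)
      · have h : |X ω| ≤ (1 / 2) * x := h
        show |X ω| ≤ 2 * x
        linarith
      · exact h.2
    · refine Disjoint.aedisjoint (Set.disjoint_left.2 fun ω h h' => ?_)
      have h : |X ω| ≤ (1 / 2) * x := h
      have h' : x ≤ |X ω| := h'.1
      linarith
  have := mul_le_mul_of_nonneg_left h1 (sq_nonneg x)
  linarith

lemma tail_aux {Ω : Type*} [MeasurableSpace Ω] (μ : Measure Ω) [IsProbabilityMeasure μ]
    (X : Ω → ℝ) (hX : AEMeasurable X μ) (x : ℝ) (hx : 0 < x) :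
    Tendsto (fun n : ℕ => μ.real {ω | 2 ^ n * x ≤ |X ω|}) atTop (nhds 0) := by
  have hXa : AEMeasurable (fun ω => |X ω|) μ := by
    simpa only [Real.norm_eq_abs] using hX.norm
  have h := tendsto_measure_iInter_atTop (μ := μ) (s := fun n : ℕ => {ω | 2 ^ n * x ≤ |X ω|})
    (fun n => nullMeasurableSet_le aemeasurable_const hXa) ?_ ⟨0, measure_ne_top _ _⟩
  · have he : (⋂ n : ℕ, {ω | 2 ^ n * x ≤ |X ω|}) = ∅ := by
      refine Set.eq_empty_of_forall_notMem fun ω hω => ?_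
      obtain ⟨n, hn⟩ := pow_unbounded_of_one_lt (|X ω| / x) (one_lt_two)
      have h2 : 2 ^ n * x ≤ |X ω| := Set.mem_iInter.1 hω n
      rw [div_lt_iff₀ hx] at hn
      linarith
    rw [he, measure_empty] at h
    have := (ENNReal.tendsto_toReal ENNReal.zero_ne_top).comp h
    simpa [Measure.real, Function.comp_def] using this
  · intro m n hmn ω hω
    have hω : 2 ^ n * x ≤ |X ω| := hω
    show 2 ^ m * x ≤ |X ω|
    refine le_trans ?_ hω
    gcongr
    norm_num

/-- If `X` is a random variable with `E X = 0` and
`l x = E[|X|² 1_{|X| ≤ x}]` is slowly varying as `x → ∞` with `E|X|² = ∞`, then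
`P(|X| ≥ x) = o(l(x)/x²)` as `x → ∞`. -/
theorem tail_prob_littleO_of_slowly_varying
    {Ω : Type*} [MeasureSpace Ω] [IsProbabilityMeasure (ℙ : Measure Ω)]
    (X : Ω → ℝ) (hX : AEMeasurable X ℙ)
    (hmean : ∫ ω, X ω ∂ℙ = 0)
    (l : ℝ → ℝ)
    (hl : ∀ x : ℝ, l x = ∫ ω in {ω | |X ω| ≤ x}, |X ω| ^ 2 ∂ℙ)
    (hslow : ∀ c : ℝ, 0 < c → Tendsto (fun x => l (c * x) / l x) atTop (nhds 1))
    (hinf : ¬ Integrable (fun ω => |X ω| ^ 2) ℙ) :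
    (fun x : ℝ => ((ℙ : Measure Ω) {ω | x ≤ |X ω|}).toReal) =o[atTop] (fun x => l x / x ^ 2) := by
  have hl0 : ∀ x, 0 ≤ l x := fun x => by
    rw [hl]; exact integral_nonneg fun ω => by positivity
  rw [isLittleO_iff]
  intro ε hε
  set T : ℝ → ℝ := fun x => (ℙ : Measure Ω).real {ω | x ≤ |X ω|} with hT
  have e1 : ∀ᶠ x in atTop, l (2 * x) / l x < 1 + min (ε / 4) 1 :=
    (hslow 2 two_pos).eventually_lt_const (by simp [hε])
  have e2 : ∀ᶠ x in atTop, 1 - min (ε / 4) (1 / 2) < l ((1 / 2) * x) / l x :=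
    (hslow (1 / 2) (by norm_num)).eventually_const_lt (by simp [hε])
  obtain ⟨x0, hx0⟩ := eventually_atTop.1 ((e1.and e2).and (eventually_gt_atTop 0))
  have main : ∀ x, x0 ≤ x → 0 < x ∧ l (2 * x) ≤ 2 * l x ∧ T x ≤ ε / 2 * (l x / x ^ 2) + T (2 * x) := by
    intro x hx
    obtain ⟨⟨h1, h2⟩, hxp⟩ := hx0 x hx
    have m1 := min_le_left (ε / 4) 1
    have m2 := min_le_right (ε / 4) 1
    have m3 := min_le_left (ε / 4) (1 / 2)
    have m4 := min_le_right (ε / 4) (1 / 2)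
    have hlp : 0 < l x := by
      refine lt_of_le_of_ne (hl0 x) fun h => ?_
      rw [← h, div_zero] at h2
      linarith
    rw [div_lt_iff₀ hlp] at h1
    rw [lt_div_iff₀ hlp] at h2
    refine ⟨hxp, by nlinarith, ?_⟩
    have hk := key_aux (ℙ : Measure Ω) X hX x hxp
    rw [← hl, ← hl] at hk
    change x ^ 2 * T x ≤ _ - _ + x ^ 2 * T (2 * x) at hk
    have hd : l (2 * x) - l (1 / 2 * x) ≤ ε / 2 * l x := by nlinarith
    have hx2 : 0 < x ^ 2 := by positivity
    have : x ^ 2 * (ε / 2 * (l x / x ^ 2) + T (2 * x)) = ε / 2 * l x + x ^ 2 * T (2 * x) := by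
      field_simp
    refine le_of_mul_le_mul_left ?_ hx2
    linarith
  have ind : ∀ n : ℕ, ∀ x, x0 ≤ x → T x ≤ ε * (l x / x ^ 2) + T (2 ^ n * x) := by
    intro n
    induction n with
    | zero =>
      intro x hx
      have := hl0 x
      have : 0 ≤ ε * (l x / x ^ 2) := by positivity
      simpa using this
    | succ n ih =>
      intro x hx
      obtain ⟨hxp, h2, h3⟩ := main x hx
      have h4 := ih (2 * x) (by linarith)
      have h5 : ε * (l (2 * x) / (2 * x) ^ 2) ≤ ε / 2 * (l x / x ^ 2) := by
        calc ε * (l (2 * x) / (2 * x) ^ 2) ≤ ε * ((2 * l x) / (2 * x) ^ 2) := by gcongr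
          _ = ε / 2 * (l x / x ^ 2) := by field_simp
      have h6 : (2 : ℝ) ^ (n + 1) * x = 2 ^ n * (2 * x) := by ring
      rw [h6]
      linarith
  filter_upwards [eventually_ge_atTop x0] with x hx
  have hxp := (main x hx).1
  have ht := (tail_aux (ℙ : Measure Ω) X hX x hxp).const_add (ε * (l x / x ^ 2))
  have hfin : T x ≤ ε * (l x / x ^ 2) + 0 := ge_of_tendsto' ht fun n => ind n x hx
  have hq : 0 ≤ l x / x ^ 2 := div_nonneg (hl0 x) (sq_nonneg x)
  rw [Real.norm_of_nonneg ENNReal.toReal_nonneg, Real.norm_of_nonneg hq]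
  simpa [hT, Measure.real] using hfin
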